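/- arXiv:2503.23473 — 14 statements merged into one kernel-verified Lean document; each statement's English description precedes it below -/
import Mathlib

section
/- Let λ be a real number. For every natural number n and every real number x, the degenerate rising factorial ⟨x⟩_{n,λ} = ∏_{i=0}^{n-1}(x + iλ) admits the expansion ⟨x⟩_{n,λ} = Σ_{k=0}^{n} c_λ(n,k) · (x)_k, where (x)_k = ∏_{i=0}^{k-1}(x - i) is the falling factorial and c_λ(n,k) = (1/k!) · Σ_{j=0}^{k} (-1)^{k-j} · C(k,j) · ⟨j⟩_{n,λ}. (This combines the definition of the heterogeneous Stirling numbers of the second kind H_λ(n,k) with their explicit formula.) -/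
open Polynomial in
/-- **Newton's forward difference formula** for real polynomials, in terms of falling factorials. -/
theorem Polynomial.eval_eq_sum_fwdDiff_mul_prod (P : Polynomial ℝ) {n : ℕ} (hP : P.natDegree ≤ n)
    (x : ℝ) :
    P.eval x = ∑ k ∈ Finset.range (n + 1),
      ((1 / (k.factorial : ℝ)) *
        ∑ j ∈ Finset.range (k + 1), (-1 : ℝ) ^ (k - j) * (k.choose j : ℝ) * P.eval (j : ℝ)) *
      ∏ i ∈ Finset.range k, (x - (i : ℝ)) := by
  have coeff (k : ℕ) :
      ∑ j ∈ Finset.range (k + 1), (-1 : ℝ) ^ (k - j) * (k.choose j : ℝ) * P.eval (j : ℝ) =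
        (fwdDiff 1)^[k] P.eval 0 := by
    simp [fwdDiff_iter_eq_sum_shift]
  simp_rw [coeff]
  set Q : Polynomial ℝ := ∑ k ∈ Finset.range (n + 1),
    C (1 / (k.factorial : ℝ) * (fwdDiff 1)^[k] P.eval 0) * ∏ i ∈ Finset.range k, (X - C (i : ℝ))
    with hQ
  have eval_Q (y : ℝ) : Q.eval y = ∑ k ∈ Finset.range (n + 1),
      (1 / (k.factorial : ℝ) * (fwdDiff 1)^[k] P.eval 0) * ∏ i ∈ Finset.range k, (y - (i : ℝ)) := by
    simp [hQ, eval_finsetSum, eval_prod]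
  rw [← eval_Q]
  congr 1
  refine eq_of_infinite_eval_eq _ _ ((Set.infinite_range_of_injective
    (Nat.cast_injective (R := ℝ))).mono ?_)
  rintro _ ⟨m, rfl⟩
  have newton := shift_eq_sum_fwdDiff_iter (1 : ℝ) P.eval m 0
  simp only [zero_add, nsmul_eq_mul, mul_one] at newton
  have term (k : ℕ) : (1 / (k.factorial : ℝ) * (fwdDiff 1)^[k] P.eval 0) *
      ∏ i ∈ Finset.range k, ((m : ℝ) - (i : ℝ)) = (m.choose k : ℝ) * (fwdDiff 1)^[k] P.eval 0 := by
    rw [← descPochhammer_eval_eq_prod_range, descPochhammer_eval_eq_descFactorial,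
      Nat.descFactorial_eq_factorial_mul_choose]
    have := k.factorial_ne_zero
    push_cast
    field_simp
  rw [Set.mem_ofPred_eq, newton, eval_Q, Finset.sum_congr rfl fun k _ => term k]
  trans ∑ k ∈ Finset.range (max m n + 1), (m.choose k : ℝ) * (fwdDiff 1)^[k] P.eval 0
  · refine Finset.sum_subset (Finset.range_mono (by omega)) fun k _ hk => ?_
    rw [Nat.choose_eq_zero_of_lt (by simpa [Nat.lt_succ_iff] using hk), Nat.cast_zero, zero_mul]
  · refine (Finset.sum_subset (Finset.range_mono (by omega)) fun k _ hk => ?_).symm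
    rw [fwdDiff_iter_eq_zero_of_degree_lt (hP.trans_lt (by simpa [Nat.lt_succ_iff] using hk)),
      Pi.zero_apply, mul_zero]


/-- Heterogeneous Stirling numbers of the second kind: definition combined with
their explicit formula.  For every real `λ`, natural `n` and real `x`,
`⟨x⟩_{n,λ} = ∑_{k=0}^n H_λ(n,k) (x)_k` where
`H_λ(n,k) = (1/k!) ∑_{j=0}^k (-1)^{k-j} C(k,j) ⟨j⟩_{n,λ}`. -/
theorem heterogeneous_stirling_second_kind_expansion (l : ℝ) (n : ℕ) (x : ℝ) :
    (∏ i ∈ Finset.range n, (x + (i : ℝ) * l)) =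
      ∑ k ∈ Finset.range (n + 1),
        ((1 / (k.factorial : ℝ)) *
          ∑ j ∈ Finset.range (k + 1),
            (-1 : ℝ) ^ (k - j) * (k.choose j : ℝ) *
              ∏ i ∈ Finset.range n, ((j : ℝ) + (i : ℝ) * l)) *
        ∏ i ∈ Finset.range k, (x - (i : ℝ)) := by
  have degree_le : (∏ i ∈ Finset.range n,
      (Polynomial.X + Polynomial.C ((i : ℝ) * l))).natDegree ≤ n := by
    rw [Polynomial.natDegree_prod_of_monic _ _ fun i _ => Polynomial.monic_X_add_C _]
    simp only [Polynomial.natDegree_X_add_C, Finset.sum_const, Finset.card_range, smul_eq_mul,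
      mul_one, le_refl]
  have h := Polynomial.eval_eq_sum_fwdDiff_mul_prod _ degree_le x
  simpa only [Polynomial.eval_prod, Polynomial.eval_add, Polynomial.eval_X,
    Polynomial.eval_C] using h
end

section
/- Let λ be a real number and let H : ℕ → ℕ → ℝ satisfy H(n,k) = 0 for k > n and, for all natural numbers n and all real x, ⟨x⟩_{n,λ} = Σ_{k=0}^{n} H(n,k) · (x)_k (the heterogeneous Stirling numbers of the second kind). Then for all natural numbers n and k one has the recurrence H(n+1, k+1) = H(n, k) + (k + 1 + nλ) · H(n, k+1), and moreover H(n+1, 0) = nλ · H(n, 0). -/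
/-- Falling factorials are linearly independent as functions on the natural numbers. -/
theorem eq_of_sum_mul_fallingFactorial_eq {N : ℕ} {a b : ℕ → ℝ}
    (h : ∀ x : ℝ, ∑ k ∈ Finset.range N, a k * ∏ i ∈ Finset.range k, (x - (i : ℝ)) =
      ∑ k ∈ Finset.range N, b k * ∏ i ∈ Finset.range k, (x - (i : ℝ))) {m : ℕ} (hm : m < N) :
    a m = b m := by
  induction m using Nat.strong_induction_on with
  | _ m ih =>
    have hsum : ∑ k ∈ Finset.range N, (a k - b k) * ∏ i ∈ Finset.range k, ((m : ℝ) - (i : ℝ)) =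
        0 := by
      simp only [sub_mul, Finset.sum_sub_distrib, h, sub_self]
    rw [Finset.sum_eq_single_of_mem m (Finset.mem_range.2 hm)] at hsum
    · have hprod : ∏ i ∈ Finset.range m, ((m : ℝ) - (i : ℝ)) ≠ 0 := by
        refine Finset.prod_ne_zero_iff.2 fun i hi => sub_ne_zero.2 ?_
        exact_mod_cast (Finset.mem_range.1 hi).ne'
      exact sub_eq_zero.1 ((mul_eq_zero.1 hsum).resolve_right hprod)
    · intro k _ hkm
      rcases hkm.lt_or_gt with hlt | hgt
      · rw [ih k hlt (hlt.trans hm), sub_self, zero_mul]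
      · rw [Finset.prod_eq_zero (Finset.mem_range.2 hgt) (sub_self _), mul_zero]

/-- Multiplying an expansion in falling factorials by `x + c`. -/
theorem sum_mul_fallingFactorial_mul_add {n : ℕ} {a : ℕ → ℝ} (ha : a (n + 1) = 0) (c x : ℝ) :
    (∑ k ∈ Finset.range (n + 1), a k * ∏ i ∈ Finset.range k, (x - (i : ℝ))) * (x + c) =
      ∑ k ∈ Finset.range (n + 1),
        (a k + ((k : ℝ) + 1 + c) * a (k + 1)) * ∏ i ∈ Finset.range (k + 1), (x - (i : ℝ)) +
      c * a 0 := by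
  have hshift : ∑ k ∈ Finset.range (n + 1),
        ((k : ℝ) + c) * a k * ∏ i ∈ Finset.range k, (x - (i : ℝ)) =
      ∑ k ∈ Finset.range (n + 1),
        ((k : ℝ) + 1 + c) * a (k + 1) * ∏ i ∈ Finset.range (k + 1), (x - (i : ℝ)) +
      c * a 0 := by
    have h := Finset.sum_range_succ
      (fun k : ℕ => ((k : ℝ) + c) * a k * ∏ i ∈ Finset.range k, (x - (i : ℝ))) (n + 1)
    rw [Finset.sum_range_succ'] at h
    simpa [ha] using h.symm
  simp only [add_mul (a _), Finset.sum_add_distrib]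
  rw [add_assoc, ← hshift, ← Finset.sum_add_distrib, Finset.sum_mul]
  refine Finset.sum_congr rfl fun k _ => ?_
  rw [Finset.prod_range_succ]
  ring

/-- Recurrence relation for the heterogeneous Stirling numbers of the second kind:
`H(n+1,k+1) = H(n,k) + (k+1+nλ) H(n,k+1)` and `H(n+1,0) = nλ H(n,0)`. -/
theorem heterogeneous_stirling_second_kind_recurrence (l : ℝ) (H : ℕ → ℕ → ℝ)
    (hH0 : ∀ n k, n < k → H n k = 0)
    (hH : ∀ (n : ℕ) (x : ℝ),
      (∏ i ∈ Finset.range n, (x + (i : ℝ) * l)) =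
        ∑ k ∈ Finset.range (n + 1), H n k * ∏ i ∈ Finset.range k, (x - (i : ℝ))) :
    (∀ n k : ℕ, H (n + 1) (k + 1) =
        H n k + ((k : ℝ) + 1 + (n : ℝ) * l) * H n (k + 1)) ∧
    (∀ n : ℕ, H (n + 1) 0 = (n : ℝ) * l * H n 0) := by
  have key (n : ℕ) {m : ℕ} (hm : m < n + 2) : H (n + 1) m =
      Nat.casesOn m ((n : ℝ) * l * H n 0)
        (fun k => H n k + ((k : ℝ) + 1 + (n : ℝ) * l) * H n (k + 1)) := by
    refine eq_of_sum_mul_fallingFactorial_eq (a := H (n + 1)) (b := fun m =>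
      Nat.casesOn m ((n : ℝ) * l * H n 0)
        (fun k => H n k + ((k : ℝ) + 1 + (n : ℝ) * l) * H n (k + 1))) (fun x => ?_) hm
    rw [← hH (n + 1) x, Finset.prod_range_succ, hH n x,
      sum_mul_fallingFactorial_mul_add (hH0 n (n + 1) n.lt_succ_self),
      Finset.sum_range_succ' _ (n + 1)]
    simp
  refine ⟨fun n k => ?_, fun n => key n (Nat.succ_pos _)⟩
  rcases lt_or_ge n k with hk | hk
  · rw [hH0 (n + 1) (k + 1) (by omega), hH0 n k hk, hH0 n (k + 1) (by omega)]
    ring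
  · exact key n (by omega)
end

section
/- Let λ be a real number and let G : ℕ → ℕ → ℝ satisfy G(n,k) = 0 for k > n and, for all natural numbers n and all real x, (x)_n = Σ_{k=0}^{n} G(n,k) · ⟨x⟩_{k,λ} (the heterogeneous Stirling numbers of the first kind). Then for all natural numbers n and k one has the recurrence G(n+1, k+1) = G(n, k) - (n + (k+1)λ) · G(n, k+1), and moreover G(n+1, 0) = -n · G(n, 0). -/
/-- The Newton-type products `∏ i < k, (x + b i)` are linearly independent as functions of `x`. -/
theorem eq_of_forall_sum_mul_prod_add_eq {N : ℕ} {b c d : ℕ → ℝ}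
    (h : ∀ x : ℝ, ∑ k ∈ Finset.range N, c k * ∏ i ∈ Finset.range k, (x + b i) =
      ∑ k ∈ Finset.range N, d k * ∏ i ∈ Finset.range k, (x + b i))
    {k : ℕ} (hk : k < N) : c k = d k := by
  let S : Polynomial.Sequence ℝ :=
    { elems' := fun k => ∏ i ∈ Finset.range k, (Polynomial.X + Polynomial.C (b i))
      degree_eq' := fun k => by simp [Polynomial.degree_prod] }
  have hS : ∀ k, S k = ∏ i ∈ Finset.range k, (Polynomial.X + Polynomial.C (b i)) := fun _ => rfl
  have hsum : ∑ k ∈ Finset.range N, (c k - d k) • S k = 0 := by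
    refine Polynomial.funext fun x => ?_
    simp [hS, Polynomial.eval_finsetSum, Polynomial.eval_prod, sub_mul, h x]
  exact sub_eq_zero.mp <|
    linearIndependent_iff'.mp S.linearIndependent _ _ hsum k (Finset.mem_range.mpr hk)

/-- Recurrence relation for the heterogeneous Stirling numbers of the first kind:
`G(n+1,k+1) = G(n,k) - (n+(k+1)λ) G(n,k+1)` and `G(n+1,0) = -n G(n,0)`. -/
theorem heterogeneous_stirling_first_kind_recurrence (l : ℝ) (G : ℕ → ℕ → ℝ)
    (hG0 : ∀ n k, n < k → G n k = 0)
    (hG : ∀ (n : ℕ) (x : ℝ),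
      (∏ i ∈ Finset.range n, (x - (i : ℝ))) =
        ∑ k ∈ Finset.range (n + 1), G n k * ∏ i ∈ Finset.range k, (x + (i : ℝ) * l)) :
    (∀ n k : ℕ, G (n + 1) (k + 1) =
        G n k - ((n : ℝ) + ((k : ℝ) + 1) * l) * G n (k + 1)) ∧
    (∀ n : ℕ, G (n + 1) 0 = -(n : ℝ) * G n 0) := by
  let c : ℕ → ℕ → ℝ
    | n, 0 => -(n : ℝ) * G n 0
    | n, j + 1 => G n j - ((n : ℝ) + ((j : ℝ) + 1) * l) * G n (j + 1)
  have key : ∀ n k, k < n + 1 + 1 → G (n + 1) k = c n k := by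
    intro n k hk
    refine eq_of_forall_sum_mul_prod_add_eq (b := fun i => (i : ℝ) * l) (fun x => ?_) hk
    have hshift := Finset.sum_range_succ' (fun k : ℕ => ((n : ℝ) + (k : ℝ) * l) * G n k *
      ∏ i ∈ Finset.range k, (x + (i : ℝ) * l)) (n + 1)
    rw [Finset.sum_range_succ, hG0 n (n + 1) n.lt_succ_self] at hshift
    have hmul : (∑ k ∈ Finset.range (n + 1), G n k * ∏ i ∈ Finset.range k, (x + (i : ℝ) * l)) *
        (x - n) = ∑ k ∈ Finset.range (n + 1), G n k * ∏ i ∈ Finset.range (k + 1), (x + (i : ℝ) * l)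
          - ∑ k ∈ Finset.range (n + 1), ((n : ℝ) + (k : ℝ) * l) * G n k *
            ∏ i ∈ Finset.range k, (x + (i : ℝ) * l) := by
      rw [Finset.sum_mul, ← Finset.sum_sub_distrib]
      refine Finset.sum_congr rfl fun k _ => ?_
      rw [Finset.prod_range_succ]
      ring
    rw [← hG (n + 1) x, Finset.prod_range_succ, hG n x, hmul, Finset.sum_range_succ' _ (n + 1)]
    simp only [c, sub_mul, Finset.sum_sub_distrib]
    push_cast at hshift
    simp only [Finset.prod_range_zero] at hshift ⊢
    linarith
  refine ⟨fun n k => ?_, fun n => key n 0 (by omega)⟩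
  rcases lt_or_ge (k + 1) (n + 1 + 1) with hk | hk
  · exact key n (k + 1) hk
  · rw [hG0 (n + 1) (k + 1) (by omega), hG0 n k (by omega), hG0 n (k + 1) (by omega)]
    ring
end

section
/- Let λ be a real number. Let H : ℕ → ℕ → ℝ satisfy H(n,k) = 0 for k > n and, for all n and all real x, ⟨x⟩_{n,λ} = Σ_{k=0}^{n} H(n,k) · (x)_k (the heterogeneous Stirling numbers of the second kind). Let S2 : ℕ → ℕ → ℝ satisfy S2(n,k) = 0 for k > n and, for all n and all real x, x^n = Σ_{k=0}^{n} S2(n,k) · (x)_k (the Stirling numbers of the second kind), and let c : ℕ → ℕ → ℝ satisfy c(n,l) = 0 for l > n and, for all n and all real x, ⟨x⟩_n = Σ_{l=0}^{n} c(n,l) · x^l (the unsigned Stirling numbers of the first kind). Then for all n ≥ k ≥ 0: H(n,k) = Σ_{l=k}^{n} S2(l,k) · c(n,l) · λ^{n-l}. -/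
/-- The falling factorials are linearly independent as real functions. -/
theorem eq_zero_of_sum_mul_falling_factorial_eq_zero (N : ℕ) (a : ℕ → ℝ)
    (h : ∀ x : ℝ, ∑ k ∈ Finset.range N, a k * ∏ i ∈ Finset.range k, (x - (i : ℝ)) = 0)
    (k : ℕ) (hk : k < N) : a k = 0 := by
  induction k using Nat.strong_induction_on with
  | _ k ih =>
    have hsum := h k
    rw [Finset.sum_eq_single_of_mem k (Finset.mem_range.2 hk)] at hsum
    · refine (mul_eq_zero.1 hsum).resolve_right (Finset.prod_ne_zero_iff.2 fun i hi => ?_)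
      exact sub_ne_zero.2 (Nat.cast_injective.ne (Finset.mem_range.1 hi).ne')
    · intro j _ hjk
      rcases hjk.lt_or_gt with hlt | hgt
      · rw [ih j hlt (hlt.trans hk), zero_mul]
      · rw [Finset.prod_eq_zero (Finset.mem_range.2 hgt) (sub_self _), mul_zero]

/-- Homogenization of the monomial expansion of a rising factorial. -/
theorem prod_add_natCast_mul_eq_sum (n : ℕ) (c : ℕ → ℝ)
    (hc : ∀ x : ℝ, (∏ i ∈ Finset.range n, (x + (i : ℝ))) =
      ∑ m ∈ Finset.range (n + 1), c m * x ^ m) (x l : ℝ) :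
    (∏ i ∈ Finset.range n, (x + (i : ℝ) * l)) =
      ∑ m ∈ Finset.range (n + 1), c m * l ^ (n - m) * x ^ m := by
  have key : (fun t : ℝ => ∏ i ∈ Finset.range n, (x + (i : ℝ) * t)) =
      fun t => ∑ m ∈ Finset.range (n + 1), c m * t ^ (n - m) * x ^ m := by
    refine Continuous.ext_on (dense_compl_singleton (0 : ℝ)) (by fun_prop) (by fun_prop) ?_
    intro t ht
    have ht0 : t ≠ 0 := ht
    calc ∏ i ∈ Finset.range n, (x + (i : ℝ) * t)
        = ∏ i ∈ Finset.range n, (t * (x / t + (i : ℝ))) :=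
          Finset.prod_congr rfl fun i _ => by field_simp
      _ = t ^ n * ∑ m ∈ Finset.range (n + 1), c m * (x / t) ^ m := by
          rw [Finset.prod_mul_distrib, hc, Finset.prod_const, Finset.card_range]
      _ = ∑ m ∈ Finset.range (n + 1), c m * t ^ (n - m) * x ^ m := by
          rw [Finset.mul_sum]
          refine Finset.sum_congr rfl fun m hm => ?_
          rw [← pow_sub_mul_pow t (Finset.mem_range_succ_iff.1 hm), div_pow]
          field_simp
  exact congrFun key l

/-- Explicit expression of the heterogeneous Stirling numbers of the second kind
in terms of Stirling numbers of both kinds: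
`H_λ(n,k) = ∑_{l=k}^n S2(l,k) · c(n,l) · λ^{n-l}` for `n ≥ k`. -/
theorem heterogeneous_stirling_second_kind_via_stirling (l : ℝ)
    (H : ℕ → ℕ → ℝ)
    (hH0 : ∀ n k, n < k → H n k = 0)
    (hH : ∀ (n : ℕ) (x : ℝ),
      (∏ i ∈ Finset.range n, (x + (i : ℝ) * l)) =
        ∑ k ∈ Finset.range (n + 1), H n k * ∏ i ∈ Finset.range k, (x - (i : ℝ)))
    (S2 : ℕ → ℕ → ℝ)
    (hS20 : ∀ n k, n < k → S2 n k = 0)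
    (hS2 : ∀ (n : ℕ) (x : ℝ),
      x ^ n = ∑ k ∈ Finset.range (n + 1), S2 n k * ∏ i ∈ Finset.range k, (x - (i : ℝ)))
    (c : ℕ → ℕ → ℝ)
    (hc0 : ∀ n m, n < m → c n m = 0)
    (hc : ∀ (n : ℕ) (x : ℝ),
      (∏ i ∈ Finset.range n, (x + (i : ℝ))) =
        ∑ m ∈ Finset.range (n + 1), c n m * x ^ m) :
    ∀ n k : ℕ, k ≤ n →
      H n k = ∑ m ∈ Finset.Icc k n, S2 m k * c n m * l ^ (n - m) := by
  intro n k hkn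
  have hpow : ∀ m ≤ n, ∀ x : ℝ, x ^ m =
      ∑ j ∈ Finset.range (n + 1), S2 m j * ∏ i ∈ Finset.range j, (x - (i : ℝ)) := by
    intro m hm x
    rw [hS2]
    refine Finset.sum_subset (Finset.range_mono (by omega)) fun j _ hj => ?_
    rw [hS20 m j (by simpa using hj), zero_mul]
  have hcoeff := eq_zero_of_sum_mul_falling_factorial_eq_zero (n + 1)
    (fun j => H n j - ∑ m ∈ Finset.range (n + 1), S2 m j * c n m * l ^ (n - m))
    (fun x => by
      simp only [sub_mul, Finset.sum_sub_distrib]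
      rw [← hH, prod_add_natCast_mul_eq_sum n (c n) (hc n), sub_eq_zero]
      simp only [Finset.sum_mul]
      rw [Finset.sum_comm]
      refine Finset.sum_congr rfl fun m hm => ?_
      rw [hpow m (Finset.mem_range_succ_iff.1 hm), Finset.mul_sum]
      exact Finset.sum_congr rfl fun j _ => by ring)
    k (by omega)
  rw [sub_eq_zero.1 hcoeff]
  symm
  refine Finset.sum_subset (fun m hm => ?_) fun m hm hmk => ?_
  · simp only [Finset.mem_Icc, Finset.mem_range] at *
    omega
  · simp only [Finset.mem_Icc, Finset.mem_range] at *
    rw [hS20 m k (by omega), zero_mul, zero_mul]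
end

section
/- Let λ be a real number. Let A : ℕ → ℕ → ℝ satisfy A(n,k) = 0 for k > n and, for all natural numbers n and all real x, (x)_{n,λ} = Σ_{k=0}^{n} A(n,k) · (x)_k (the degenerate Stirling numbers of the second kind with parameter λ), and let B : ℕ → ℕ → ℝ satisfy B(n,l) = 0 for l > n and, for all n and all real x, ⟨x⟩_n = Σ_{l=0}^{n} B(n,l) · (x)_{l,λ} (the unsigned degenerate Stirling numbers of the first kind with parameter -λ, noting ⟨x⟩_{l,-λ} = (x)_{l,λ}). Then for all n ≥ k ≥ 1: Σ_{l=k}^{n} A(l,k) · B(n,l) = (n!/k!) · C(n-1, k-1), i.e. the sum equals the Lah number L(n,k) and is independent of λ. -/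
/-- The falling factorials are linearly independent as real functions. -/
lemma coeff_eq_zero_of_sum_mul_falling_eq_zero (N : ℕ) (c : ℕ → ℝ)
    (h : ∀ x : ℝ, ∑ k ∈ Finset.range N, c k * ∏ i ∈ Finset.range k, (x - (i : ℝ)) = 0) :
    ∀ k < N, c k = 0 := by
  intro k
  induction k using Nat.strong_induction_on with
  | _ k ih =>
    intro hk
    have hsum := h k
    rw [Finset.sum_eq_single_of_mem k (Finset.mem_range.2 hk)] at hsum
    · refine (mul_eq_zero.1 hsum).resolve_right (Finset.prod_ne_zero_iff.2 fun i hi => ?_)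
      exact sub_ne_zero.2 (Nat.cast_injective.ne (Finset.mem_range.1 hi).ne')
    · intro j hj hjk
      rcases lt_or_gt_of_ne hjk with hlt | hgt
      · rw [ih j hlt (Finset.mem_range.1 hj), zero_mul]
      · rw [Finset.prod_eq_zero (Finset.mem_range.2 hgt) (sub_self _), mul_zero]

/-- The recurrence for the Lah numbers `L(n + 2, k + 2)`. -/
lemma lah_recurrence (n k : ℕ) :
    ((n + 2).factorial : ℝ) / ((k + 2).factorial : ℝ) * ((n + 1).choose (k + 1) : ℝ) =
      ((n + 1).factorial : ℝ) / ((k + 1).factorial : ℝ) * (n.choose k : ℝ) +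
      (n + k + 3) *
        (((n + 1).factorial : ℝ) / ((k + 2).factorial : ℝ) * (n.choose (k + 1) : ℝ)) := by
  have hchoose : ((k : ℝ) + 1) * (n.choose (k + 1) : ℝ) = (n - k) * (n.choose k : ℝ) := by
    have h₁ : ((n : ℝ) + 1) * (n.choose k : ℝ) = ((n + 1).choose (k + 1) : ℝ) * (k + 1) := by
      exact_mod_cast Nat.add_one_mul_choose_eq n k
    rw [Nat.choose_succ_succ] at h₁
    push_cast at h₁
    linarith
  have hk : ((k + 1).factorial : ℝ) ≠ 0 := by positivity
  have hk' : (k : ℝ) + 2 ≠ 0 := by positivity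
  rw [Nat.choose_succ_succ, Nat.factorial_succ (n + 1), Nat.factorial_succ (k + 1)]
  push_cast
  rw [show (k : ℝ) + 1 + 1 = k + 2 by ring]
  field_simp
  linear_combination -hchoose

/-- Expansion of rising factorials in falling factorials, with Lah numbers as coefficients. -/
lemma rising_eq_sum_lah_mul_falling (n : ℕ) (x : ℝ) :
    ∏ i ∈ Finset.range (n + 1), (x + (i : ℝ)) =
      ∑ k ∈ Finset.range (n + 1), ((n + 1).factorial : ℝ) / ((k + 1).factorial : ℝ) *
        (n.choose k : ℝ) * ∏ i ∈ Finset.range (k + 1), (x - (i : ℝ)) := by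
  induction n with
  | zero => simp
  | succ n ih =>
    rw [Finset.prod_range_succ, ih, Finset.sum_mul]
    have hsplit : ∀ k ∈ Finset.range (n + 1),
        ((n + 1).factorial : ℝ) / ((k + 1).factorial : ℝ) * (n.choose k : ℝ) *
            (∏ i ∈ Finset.range (k + 1), (x - (i : ℝ))) * (x + ((n + 1 : ℕ) : ℝ)) =
          ((n + 1).factorial : ℝ) / ((k + 1).factorial : ℝ) * (n.choose k : ℝ) *
            (∏ i ∈ Finset.range (k + 2), (x - (i : ℝ))) +
          (n + k + 2) * (((n + 1).factorial : ℝ) / ((k + 1).factorial : ℝ) *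
            (n.choose k : ℝ)) * ∏ i ∈ Finset.range (k + 1), (x - (i : ℝ)) := by
      intro k _
      rw [Finset.prod_range_succ _ (k + 1)]
      push_cast
      ring
    rw [Finset.sum_congr rfl hsplit, Finset.sum_add_distrib, Finset.sum_range_succ' _ (n + 1)]
    simp_rw [lah_recurrence, add_mul _ _ (Finset.prod _ _), Finset.sum_add_distrib]
    rw [add_assoc, add_right_inj, Finset.sum_range_succ',
      Finset.sum_range_succ _ n, Nat.choose_succ_self]
    simp only [Nat.factorial_succ (n + 1)]
    push_cast
    simp only [Nat.choose_zero_right, Nat.cast_one, mul_zero, zero_mul, add_zero]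
    congr 1
    · exact Finset.sum_congr rfl fun k _ => by ring
    · ring


/-- `L(n,k) = ∑_{l=k}^n A(l,k) B(n,l)` where `A` are the degenerate Stirling numbers
of the second kind with parameter `λ` and `B` are the unsigned degenerate Stirling
numbers of the first kind with parameter `-λ`; the sum is independent of `λ`. -/
theorem lah_eq_sum_degenerate_stirling (l : ℝ)
    (A : ℕ → ℕ → ℝ)
    (hA0 : ∀ n k, n < k → A n k = 0)
    (hA : ∀ (n : ℕ) (x : ℝ),
      (∏ i ∈ Finset.range n, (x - (i : ℝ) * l)) =
        ∑ k ∈ Finset.range (n + 1), A n k * ∏ i ∈ Finset.range k, (x - (i : ℝ)))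
    (B : ℕ → ℕ → ℝ)
    (hB0 : ∀ n m, n < m → B n m = 0)
    (hB : ∀ (n : ℕ) (x : ℝ),
      (∏ i ∈ Finset.range n, (x + (i : ℝ))) =
        ∑ m ∈ Finset.range (n + 1), B n m * ∏ i ∈ Finset.range m, (x - (i : ℝ) * l)) :
    ∀ n k : ℕ, 1 ≤ k → k ≤ n →
      (∑ m ∈ Finset.Icc k n, A m k * B n m) =
        (n.factorial : ℝ) / (k.factorial : ℝ) * ((n - 1).choose (k - 1) : ℝ) := by
  intro n k hk hkn
  obtain ⟨n, rfl⟩ := Nat.exists_eq_add_of_le' (hk.trans hkn)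
  obtain ⟨k, rfl⟩ := Nat.exists_eq_add_of_le' hk
  have hA' : ∀ m ∈ Finset.range (n + 2), ∀ x : ℝ,
      ∏ i ∈ Finset.range m, (x - (i : ℝ) * l) =
        ∑ j ∈ Finset.range (n + 2), A m j * ∏ i ∈ Finset.range j, (x - (i : ℝ)) := by
    intro m hm x
    rw [hA]
    refine Finset.sum_subset (Finset.range_mono (Finset.mem_range.1 hm)) fun j _ hj => ?_
    rw [hA0 m j (by simpa using hj), zero_mul]
  set c : ℕ → ℝ := fun j => ∑ m ∈ Finset.range (n + 2), A m j * B (n + 1) m with hc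
  set d : ℕ → ℝ := fun j => if j = 0 then 0 else
    ((n + 1).factorial : ℝ) / (j.factorial : ℝ) * (n.choose (j - 1) : ℝ) with hd
  have hcx : ∀ x : ℝ, ∏ i ∈ Finset.range (n + 1), (x + (i : ℝ)) =
      ∑ j ∈ Finset.range (n + 2), c j * ∏ i ∈ Finset.range j, (x - (i : ℝ)) := by
    intro x
    simp_rw [hB, hc, Finset.sum_mul]
    rw [Finset.sum_comm]
    refine Finset.sum_congr rfl fun m hm => ?_
    rw [hA' m hm, Finset.mul_sum]
    exact Finset.sum_congr rfl fun j _ => by ring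
  have hdx : ∀ x : ℝ, ∏ i ∈ Finset.range (n + 1), (x + (i : ℝ)) =
      ∑ j ∈ Finset.range (n + 2), d j * ∏ i ∈ Finset.range j, (x - (i : ℝ)) := by
    intro x
    rw [rising_eq_sum_lah_mul_falling, Finset.sum_range_succ' _ (n + 1)]
    simp [hd]
  have hcd := coeff_eq_zero_of_sum_mul_falling_eq_zero (n + 2) (fun j => c j - d j)
    (fun x => by simp only [sub_mul, Finset.sum_sub_distrib, ← hcx, ← hdx, sub_self])
    (k + 1) (by omega)
  have hcd' : c (k + 1) = d (k + 1) := sub_eq_zero.1 hcd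
  calc ∑ m ∈ Finset.Icc (k + 1) (n + 1), A m (k + 1) * B (n + 1) m
      = c (k + 1) := by
        refine Finset.sum_subset (fun m hm => ?_) fun m hm hm' => ?_
        · simp only [Finset.mem_Icc, Finset.mem_range] at *
          omega
        · simp only [Finset.mem_Icc, Finset.mem_range] at *
          rw [hA0 m (k + 1) (by omega), zero_mul]
    _ = _ := by rw [hcd']; simp [hd]
end

section
/- Let λ be a real number. Let H : ℕ → ℕ → ℝ satisfy H(n,k) = 0 for k > n and, for all n and all real x, ⟨x⟩_{n,λ} = Σ_{k=0}^{n} H(n,k) · (x)_k (the heterogeneous Stirling numbers of the second kind), and let B : ℕ → ℕ → ℝ satisfy B(n,l) = 0 for l > n and, for all n and all real x, ⟨x⟩_n = Σ_{l=0}^{n} B(n,l) · ⟨x⟩_{l,λ} (the unsigned degenerate Stirling numbers of the first kind with parameter λ). Then for all n ≥ k ≥ 1: Σ_{l=k}^{n} H(l,k) · B(n,l) = (n!/k!) · C(n-1, k-1), i.e. the sum equals the Lah number L(n,k) and is independent of λ. -/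
/-- Evaluations at the natural numbers determine the coefficients of a falling factorial
expansion. -/
theorem coeff_eq_of_sum_mul_descFactorial_eq {N : ℕ} {a b : ℕ → ℝ}
    (h : ∀ m : ℕ, ∑ k ∈ Finset.range N, a k * (m.descFactorial k : ℝ) =
      ∑ k ∈ Finset.range N, b k * (m.descFactorial k : ℝ)) :
    ∀ k < N, a k = b k := by
  intro k
  induction k using Nat.strong_induction_on with
  | _ k ih =>
    intro hk
    have hsum : ∑ j ∈ Finset.range N, (a j - b j) * (k.descFactorial j : ℝ) = 0 := by
      simp only [sub_mul, Finset.sum_sub_distrib, h k, sub_self]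
    rw [Finset.sum_eq_single k] at hsum
    · have hne : (k.descFactorial k : ℝ) ≠ 0 := by
        rw [Nat.descFactorial_self]
        exact_mod_cast k.factorial_ne_zero
      exact sub_eq_zero.mp ((mul_eq_zero.mp hsum).resolve_right hne)
    · intro j hj hjk
      rcases lt_or_gt_of_ne hjk with hlt | hgt
      · rw [ih j hlt (Finset.mem_range.mp hj), sub_self, zero_mul]
      · rw [Nat.descFactorial_of_lt hgt, Nat.cast_zero, mul_zero]
    · exact fun hk' => absurd (Finset.mem_range.mpr hk) hk'

theorem prod_range_natCast_sub (m k : ℕ) :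
    ∏ i ∈ Finset.range k, ((m : ℝ) - (i : ℝ)) = (m.descFactorial k : ℝ) := by
  rw [← descPochhammer_eval_eq_descFactorial, descPochhammer_eval_eq_prod_range]

/-- The Lah expansion of a rising factorial in falling factorials, at a natural number. -/
theorem prod_range_natCast_add_eq_sum_lah {n : ℕ} (hn : 1 ≤ n) (m : ℕ) :
    ∏ i ∈ Finset.range n, ((m : ℝ) + (i : ℝ)) =
      ∑ k ∈ Finset.range (n + 1),
        (n.factorial : ℝ) / (k.factorial : ℝ) * ((n - 1).choose (n - k) : ℝ) *
          (m.descFactorial k : ℝ) := by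
  have hasc : ∏ i ∈ Finset.range n, ((m : ℝ) + (i : ℝ)) =
      (n.factorial : ℝ) * ((m + (n - 1)).choose n : ℝ) := by
    rw [← Nat.add_sub_assoc hn, ← Nat.cast_mul, ← Nat.ascFactorial_eq_factorial_mul_choose',
      Nat.ascFactorial_eq_prod_range]
    push_cast
    rfl
  rw [hasc, Nat.add_choose_eq, Finset.Nat.sum_antidiagonal_eq_sum_range_succ_mk]
  push_cast
  rw [Finset.mul_sum]
  refine Finset.sum_congr rfl fun k _ => ?_
  have hk : (k.factorial : ℝ) ≠ 0 := by exact_mod_cast k.factorial_ne_zero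
  rw [Nat.descFactorial_eq_factorial_mul_choose]
  push_cast
  field_simp


/-- `L(n,k) = ∑_{l=k}^n H_λ(l,k) [n l]_λ` where `H_λ` are the heterogeneous
Stirling numbers of the second kind and `[n l]_λ` the unsigned degenerate Stirling
numbers of the first kind; the sum is independent of `λ`. -/
theorem lah_eq_sum_heterogeneous_stirling (l : ℝ)
    (H : ℕ → ℕ → ℝ)
    (hH0 : ∀ n k, n < k → H n k = 0)
    (hH : ∀ (n : ℕ) (x : ℝ),
      (∏ i ∈ Finset.range n, (x + (i : ℝ) * l)) =
        ∑ k ∈ Finset.range (n + 1), H n k * ∏ i ∈ Finset.range k, (x - (i : ℝ)))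
    (B : ℕ → ℕ → ℝ)
    (hB0 : ∀ n m, n < m → B n m = 0)
    (hB : ∀ (n : ℕ) (x : ℝ),
      (∏ i ∈ Finset.range n, (x + (i : ℝ))) =
        ∑ m ∈ Finset.range (n + 1), B n m * ∏ i ∈ Finset.range m, (x + (i : ℝ) * l)) :
    ∀ n k : ℕ, 1 ≤ k → k ≤ n →
      (∑ m ∈ Finset.Icc k n, H m k * B n m) =
        (n.factorial : ℝ) / (k.factorial : ℝ) * ((n - 1).choose (k - 1) : ℝ) := by
  intro n k hk hkn
  have hext : ∀ m ∈ Finset.range (n + 1), ∀ x : ℝ,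
      (∏ i ∈ Finset.range m, (x + (i : ℝ) * l)) =
        ∑ j ∈ Finset.range (n + 1), H m j * ∏ i ∈ Finset.range j, (x - (i : ℝ)) := by
    intro m hm x
    rw [hH]
    refine Finset.sum_subset (Finset.range_mono (Finset.mem_range.mp hm)) fun j _ hj => ?_
    rw [hH0 m j (by simpa using hj), zero_mul]
  have hcoeff := coeff_eq_of_sum_mul_descFactorial_eq (N := n + 1)
    (a := fun j => ∑ m ∈ Finset.range (n + 1), H m j * B n m)
    (b := fun j => (n.factorial : ℝ) / (j.factorial : ℝ) * ((n - 1).choose (n - j) : ℝ))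
    (fun x => by
      rw [← prod_range_natCast_add_eq_sum_lah (hk.trans hkn), hB]
      simp only [Finset.sum_mul]
      rw [Finset.sum_comm]
      refine Finset.sum_congr rfl fun m hm => ?_
      rw [hext m hm, Finset.mul_sum]
      refine Finset.sum_congr rfl fun j _ => ?_
      rw [prod_range_natCast_sub]
      ring) k (Nat.lt_succ_of_le hkn)
  have hsub : ∑ m ∈ Finset.Icc k n, H m k * B n m =
      ∑ m ∈ Finset.range (n + 1), H m k * B n m := by
    refine Finset.sum_subset (fun m hm => ?_) fun m hm hm' => ?_
    · simp only [Finset.mem_Icc, Finset.mem_range] at hm ⊢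
      omega
    · simp only [Finset.mem_Icc, Finset.mem_range] at hm hm'
      rw [hH0 m k (by omega), zero_mul]
  rw [hsub, hcoeff, Nat.choose_symm_of_eq_add (show n - 1 = (n - k) + (k - 1) by omega)]
end

section
/- Let λ be a real number and let H : ℕ → ℕ → ℝ satisfy H(n,k) = 0 for k > n and, for all n and all real x, ⟨x⟩_{n,λ} = Σ_{k=0}^{n} H(n,k) · (x)_k (the heterogeneous Stirling numbers of the second kind). Then for every natural number n and every real number x, the series Σ_{k=0}^{∞} ⟨k⟩_{n,λ} · x^k / k! converges absolutely (is summable) and the heterogeneous Bell polynomial H_{n,λ}(x) := Σ_{k=0}^{n} H(n,k) x^k satisfies the Dobinski-like formula H_{n,λ}(x) = e^{-x} · Σ_{k=0}^{∞} ⟨k⟩_{n,λ} · x^k / k!. -/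
/-- The series of the falling factorials `(k)_m` against the exponential weights `x ^ k / k!`. -/
theorem hasSum_prod_range_sub_mul_pow_div_factorial (m : ℕ) (x : ℝ) :
    HasSum (fun k : ℕ => (∏ i ∈ Finset.range m, ((k : ℝ) - (i : ℝ))) * (x ^ k / (k.factorial : ℝ)))
      (x ^ m * Real.exp x) := by
  induction m with
  | zero => simpa [Real.exp_eq_exp_ℝ] using NormedSpace.expSeries_div_hasSum_exp x
  | succ m ih =>
    rw [← hasSum_nat_add_iff' 1]
    convert! ih.mul_left x using 1
    · funext k
      have hk : ((k : ℝ) + 1) ≠ 0 := by positivity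
      have hf : (k.factorial : ℝ) ≠ 0 := by positivity
      rw [Finset.prod_range_succ', Nat.factorial_succ]
      push_cast
      simp only [add_sub_add_right_eq_sub, sub_zero]
      field_simp
      ring
    · simp [Finset.prod_range_succ', pow_succ']
      ring


/-- Dobinski-like formula for the heterogeneous Bell polynomials:
`H_{n,λ}(x) = e^{-x} ∑_{k=0}^∞ ⟨k⟩_{n,λ} x^k / k!`, the series being summable. -/
theorem heterogeneous_bell_polynomial_dobinski (l : ℝ) (H : ℕ → ℕ → ℝ)
    (hH0 : ∀ n k, n < k → H n k = 0)
    (hH : ∀ (n : ℕ) (x : ℝ),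
      (∏ i ∈ Finset.range n, (x + (i : ℝ) * l)) =
        ∑ k ∈ Finset.range (n + 1), H n k * ∏ i ∈ Finset.range k, (x - (i : ℝ))) :
    ∀ (n : ℕ) (x : ℝ),
      Summable (fun k : ℕ =>
        (∏ i ∈ Finset.range n, ((k : ℝ) + (i : ℝ) * l)) * x ^ k / (k.factorial : ℝ)) ∧
      (∑ k ∈ Finset.range (n + 1), H n k * x ^ k) =
        Real.exp (-x) * ∑' k : ℕ,
          (∏ i ∈ Finset.range n, ((k : ℝ) + (i : ℝ) * l)) * x ^ k / (k.factorial : ℝ) := by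
  intro n x
  have h : HasSum (fun k : ℕ =>
      (∏ i ∈ Finset.range n, ((k : ℝ) + (i : ℝ) * l)) * x ^ k / (k.factorial : ℝ))
      (∑ m ∈ Finset.range (n + 1), H n m * (x ^ m * Real.exp x)) := by
    convert! hasSum_sum fun m (_ : m ∈ Finset.range (n + 1)) =>
      (hasSum_prod_range_sub_mul_pow_div_factorial m x).mul_left (H n m) using 1
    funext k
    rw [hH, mul_div_assoc, Finset.sum_mul]
    exact Finset.sum_congr rfl fun m _ => mul_assoc _ _ _
  refine ⟨h.summable, ?_⟩
  rw [h.tsum_eq, Finset.mul_sum]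
  refine Finset.sum_congr rfl fun m _ => ?_
  rw [mul_left_comm, mul_left_comm (Real.exp (-x)), ← Real.exp_add, neg_add_cancel,
    Real.exp_zero, mul_one]
end

section
/- Let λ be a real number and let H : ℕ → ℕ → ℝ satisfy H(n,k) = 0 for k > n and, for all n and all real x, ⟨x⟩_{n,λ} = Σ_{k=0}^{n} H(n,k) · (x)_k (the heterogeneous Stirling numbers of the second kind). Define the heterogeneous Bell numbers by B_n := Σ_{k=0}^{n} H(n,k). Then for all natural numbers m and n: B_{m+n} = Σ_{j=0}^{m} Σ_{k=0}^{n} C(n,k) · H(m,j) · B_k · ⟨mλ + j⟩_{n-k, λ}, where ⟨mλ + j⟩_{n-k, λ} = ∏_{i=0}^{n-k-1}(mλ + j + iλ). -/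
open Finset in
/-- Vandermonde convolution for degenerate rising factorials. -/
theorem prod_range_add_add_mul {R : Type*} [CommRing R] (l a b : R) (n : ℕ) :
    ∏ i ∈ range n, (a + b + (i : R) * l) =
      ∑ k ∈ range (n + 1), (n.choose k : R) *
        ((∏ i ∈ range k, (a + (i : R) * l)) * ∏ i ∈ range (n - k), (b + (i : R) * l)) := by
  rw [← Nat.sum_antidiagonal_eq_sum_range_succ (fun i j ↦ (n.choose i : R) *
    ((∏ t ∈ range i, (a + (t : R) * l)) * ∏ t ∈ range j, (b + (t : R) * l)))]
  induction n with
  | zero => simp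
  | succ n ih =>
    rw [sum_antidiagonal_choose_succ_mul (fun i j ↦
      (∏ t ∈ range i, (a + (t : R) * l)) * ∏ t ∈ range j, (b + (t : R) * l)),
      prod_range_succ, ih, sum_mul, ← sum_add_distrib]
    refine sum_congr rfl fun ⟨i, j⟩ hij ↦ ?_
    obtain rfl := mem_antidiagonal.1 hij
    rw [Nat.choose_symm_add]
    simp only [prod_range_succ]
    push_cast
    ring

/-- The factorial moments of the Poisson distribution with mean one, up to normalization. -/
theorem hasSum_prod_range_sub_div_factorial (k : ℕ) :
    HasSum (fun r : ℕ ↦ (∏ i ∈ Finset.range k, ((r : ℝ) - (i : ℝ))) / (r.factorial : ℝ))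
      (Real.exp 1) := by
  simp only [← descPochhammer_eval_eq_prod_range, descPochhammer_eval_eq_descFactorial]
  rw [← hasSum_nat_add_iff' k, Finset.sum_eq_zero, sub_zero]
  · have h := NormedSpace.expSeries_div_hasSum_exp (1 : ℝ)
    rw [← Real.exp_eq_exp_ℝ] at h
    refine h.congr_fun fun r ↦ ?_
    have hr : ((r + k).descFactorial k : ℝ) * (r.factorial : ℝ) = ((r + k).factorial : ℝ) := by
      have := Nat.factorial_mul_descFactorial (Nat.le_add_left k r)
      rw [Nat.add_sub_cancel, mul_comm] at this
      exact_mod_cast this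
    rw [← hr]
    have := Nat.cast_ne_zero (R := ℝ).2 r.factorial_ne_zero
    have : ((r + k).descFactorial k : ℝ) ≠ 0 :=
      left_ne_zero_of_mul (hr.trans_ne (Nat.cast_ne_zero.2 (r + k).factorial_ne_zero))
    field_simp
    simp
  · intro r hr
    simp [Nat.descFactorial_of_lt (Finset.mem_range.1 hr)]

/-- Spivey-type formula for the heterogeneous Bell numbers:
`H_{m+n,λ} = ∑_{j=0}^m ∑_{k=0}^n C(n,k) H_λ(m,j) H_{k,λ} ⟨mλ+j⟩_{n-k,λ}`. -/
theorem heterogeneous_bell_number_spivey (l : ℝ) (H : ℕ → ℕ → ℝ)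
    (hH0 : ∀ n k, n < k → H n k = 0)
    (hH : ∀ (n : ℕ) (x : ℝ),
      (∏ i ∈ Finset.range n, (x + (i : ℝ) * l)) =
        ∑ k ∈ Finset.range (n + 1), H n k * ∏ i ∈ Finset.range k, (x - (i : ℝ)))
    (B : ℕ → ℝ) (hB : ∀ n : ℕ, B n = ∑ k ∈ Finset.range (n + 1), H n k) :
    ∀ m n : ℕ,
      B (m + n) =
        ∑ j ∈ Finset.range (m + 1), ∑ k ∈ Finset.range (n + 1),
          (n.choose k : ℝ) * H m j * B k *
            ∏ i ∈ Finset.range (n - k), ((m : ℝ) * l + (j : ℝ) + (i : ℝ) * l) := by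
  have moment (j k : ℕ) : HasSum (fun r : ℕ ↦ (∏ i ∈ Finset.range j, ((r : ℝ) - (i : ℝ))) *
      (∏ i ∈ Finset.range k, ((r : ℝ) - (j : ℝ) + (i : ℝ) * l)) / (r.factorial : ℝ))
      (B k * Real.exp 1) := by
    rw [hB, Finset.sum_mul]
    refine (hasSum_sum fun i _ ↦
      (hasSum_prod_range_sub_div_factorial (j + i)).mul_left (H k i)).congr_fun fun r ↦ ?_
    rw [hH, Finset.mul_sum, Finset.sum_div]
    refine Finset.sum_congr rfl fun i _ ↦ ?_
    rw [Finset.prod_range_add]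
    simp only [Nat.cast_add, sub_add_eq_sub_sub]
    ring
  intro m n
  refine mul_right_cancel₀ (Real.exp_ne_zero 1) ((moment 0 (m + n)).unique ?_)
  simp only [Finset.sum_mul]
  have key := hasSum_sum fun j (_ : j ∈ Finset.range (m + 1)) ↦
    hasSum_sum fun k (_ : k ∈ Finset.range (n + 1)) ↦
      (moment j k).mul_left ((n.choose k : ℝ) * H m j *
        ∏ i ∈ Finset.range (n - k), ((m : ℝ) * l + (j : ℝ) + (i : ℝ) * l))
  convert! key.congr_fun fun r ↦ ?_ using 1
  · refine Finset.sum_congr rfl fun j _ ↦ Finset.sum_congr rfl fun k _ ↦ ?_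
    ring
  · simp only [Finset.range_zero, Finset.prod_empty, one_mul, Nat.cast_zero, sub_zero]
    rw [Finset.prod_range_add, hH, Finset.sum_mul, Finset.sum_div]
    refine Finset.sum_congr rfl fun j _ ↦ ?_
    have hshift (i : ℕ) : (r : ℝ) + ((m + i : ℕ) : ℝ) * l =
        (r : ℝ) - (j : ℝ) + ((m : ℝ) * l + (j : ℝ)) + (i : ℝ) * l := by
      push_cast
      ring
    simp only [hshift]
    rw [prod_range_add_add_mul, Finset.mul_sum, Finset.sum_div]
    refine Finset.sum_congr rfl fun k _ ↦ ?_
    ring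
end

section
/- Let λ be a real number and let H : ℕ → ℕ → ℝ satisfy H(n,k) = 0 for k > n and, for all n and all real x, ⟨x⟩_{n,λ} = Σ_{k=0}^{n} H(n,k) · (x)_k (the heterogeneous Stirling numbers of the second kind). Define the heterogeneous Bell polynomials H_{n,λ}(x) := Σ_{k=0}^{n} H(n,k) x^k. Then for all natural numbers m, n and every real number x: H_{n+m,λ}(x) = Σ_{k=0}^{n} Σ_{j=0}^{m} C(n,k) · H_{k,λ}(x) · H(m,j) · ⟨j + mλ⟩_{n-k, λ} · x^j, where ⟨j + mλ⟩_{n-k, λ} = ∏_{i=0}^{n-k-1}(j + mλ + iλ). -/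
open Polynomial

/-- The descending Pochhammer polynomials, as a polynomial sequence. -/
noncomputable def descPochhammerSequence (K : Type*) [Field K] : Polynomial.Sequence K where
  elems' := descPochhammer K
  degree_eq' i := by
    rw [degree_eq_natDegree (monic_descPochhammer K i).ne_zero, descPochhammer_natDegree]

theorem isUnit_leadingCoeff_descPochhammerSequence (K : Type*) [Field K] (i : ℕ) :
    IsUnit (descPochhammerSequence K i).leadingCoeff :=
  (monic_descPochhammer K i).leadingCoeff ▸ isUnit_one

/-- The umbral functional: the linear functional on polynomials sending the `k`-th falling
factorial to `x ^ k`. -/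
noncomputable def umbralFunctional {K : Type*} [Field K] (x : K) : K[X] →ₗ[K] K :=
  ((descPochhammerSequence K).basis
    (isUnit_leadingCoeff_descPochhammerSequence K)).constr K (x ^ ·)

theorem umbralFunctional_descPochhammer {K : Type*} [Field K] (x : K) (k : ℕ) :
    umbralFunctional x (descPochhammer K k) = x ^ k := by
  have h : (descPochhammerSequence K).basis (isUnit_leadingCoeff_descPochhammerSequence K) k =
      descPochhammer K k := Polynomial.Sequence.basis_eq_self _ _ k
  rw [← h, umbralFunctional, Module.Basis.constr_basis]

theorem umbralFunctional_descPochhammer_mul {K : Type*} [Field K] (x : K) (j : ℕ) (f : K[X]) :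
    umbralFunctional x (descPochhammer K j * f) =
      x ^ j * umbralFunctional x (f.comp (X + C (j : K))) := by
  suffices h : ∀ g : K[X], umbralFunctional x (descPochhammer K j * g.comp (X - C (j : K))) =
      x ^ j * umbralFunctional x g by
    have := h (f.comp (X + C (j : K)))
    rwa [comp_assoc, add_comp, X_comp, C_comp, sub_add_cancel, comp_X] at this
  intro g
  have hg : g ∈ Submodule.span K (Set.range (descPochhammerSequence K)) := by
    rw [Polynomial.Sequence.span _ (isUnit_leadingCoeff_descPochhammerSequence K)]
    trivial
  induction hg using Submodule.span_induction with
  | mem p hp =>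
    obtain ⟨k, rfl⟩ := hp
    change umbralFunctional x (descPochhammer K j * (descPochhammer K k).comp (X - C (j : K))) =
      x ^ j * umbralFunctional x (descPochhammer K k)
    rw [C_eq_natCast, descPochhammer_mul, umbralFunctional_descPochhammer,
      umbralFunctional_descPochhammer, pow_add]
  | zero => simp
  | add p q _ _ hp hq => rw [add_comp, mul_add, map_add, hp, hq, map_add, mul_add]
  | smul a p _ hp =>
    rw [smul_comp, mul_smul_comm, map_smul, hp, map_smul, smul_eq_mul, smul_eq_mul,
      mul_left_comm]

/-- Vandermonde's identity for degenerate rising factorials. -/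
theorem prod_range_add_add_mul_eq_sum_choose {R : Type*} [CommRing R] (a b l : R) (n : ℕ) :
    ∏ i ∈ Finset.range n, (a + b + i * l) =
      ∑ k ∈ Finset.range (n + 1), (n.choose k : R) *
        ((∏ i ∈ Finset.range k, (a + i * l)) * ∏ i ∈ Finset.range (n - k), (b + i * l)) := by
  rw [← Finset.Nat.sum_antidiagonal_eq_sum_range_succ (fun p q ↦ (n.choose p : R) *
    ((∏ i ∈ Finset.range p, (a + i * l)) * ∏ i ∈ Finset.range q, (b + i * l)))]
  induction n with
  | zero => simp
  | succ n ih =>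
    rw [Finset.sum_antidiagonal_choose_succ_mul (fun p q ↦
      (∏ i ∈ Finset.range p, (a + i * l)) * ∏ i ∈ Finset.range q, (b + i * l)),
      Finset.prod_range_succ, ih, Finset.sum_mul, ← Finset.sum_add_distrib]
    refine Finset.sum_congr rfl fun ⟨p, q⟩ h ↦ ?_
    obtain rfl := Finset.HasAntidiagonal.mem_antidiagonal.mp h
    rw [Finset.prod_range_succ _ p, Finset.prod_range_succ _ q, Nat.choose_symm_add]
    push_cast
    ring


/-- Spivey-type formula for the heterogeneous Bell polynomials:
`H_{n+m,λ}(x) = ∑_{k=0}^n ∑_{j=0}^m C(n,k) H_{k,λ}(x) H_λ(m,j) ⟨j+mλ⟩_{n-k,λ} x^j`. -/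
theorem heterogeneous_bell_polynomial_spivey (l : ℝ) (H : ℕ → ℕ → ℝ)
    (hH0 : ∀ n k, n < k → H n k = 0)
    (hH : ∀ (n : ℕ) (x : ℝ),
      (∏ i ∈ Finset.range n, (x + (i : ℝ) * l)) =
        ∑ k ∈ Finset.range (n + 1), H n k * ∏ i ∈ Finset.range k, (x - (i : ℝ)))
    (P : ℕ → ℝ → ℝ)
    (hP : ∀ (n : ℕ) (x : ℝ), P n x = ∑ k ∈ Finset.range (n + 1), H n k * x ^ k) :
    ∀ (m n : ℕ) (x : ℝ),
      P (n + m) x =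
        ∑ k ∈ Finset.range (n + 1), ∑ j ∈ Finset.range (m + 1),
          (n.choose k : ℝ) * P k x * H m j *
            (∏ i ∈ Finset.range (n - k), ((j : ℝ) + (m : ℝ) * l + (i : ℝ) * l)) * x ^ j := by
  intro m n x
  have hpoly (N : ℕ) : ∏ i ∈ Finset.range N, (X + (i : ℝ[X]) * C l) =
      ∑ k ∈ Finset.range (N + 1), C (H N k) * descPochhammer ℝ k := by
    refine Polynomial.funext fun y ↦ ?_
    simpa [eval_prod, eval_finsetSum, descPochhammer_eval_eq_prod_range] using hH N y
  have hL (N : ℕ) :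
      umbralFunctional x (∏ i ∈ Finset.range N, (X + (i : ℝ[X]) * C l)) = P N x := by
    simp [hpoly, hP, ← smul_eq_C_mul, umbralFunctional_descPochhammer]
  have hshift (j : ℕ) :
      (∏ i ∈ Finset.range n, (X + ((m + i : ℕ) : ℝ[X]) * C l)).comp (X + C (j : ℝ)) =
        ∑ k ∈ Finset.range (n + 1), ((n.choose k : ℝ) *
          ∏ i ∈ Finset.range (n - k), ((j : ℝ) + (m : ℝ) * l + (i : ℝ) * l)) •
            ∏ i ∈ Finset.range k, (X + (i : ℝ[X]) * C l) := by
    have := prod_range_add_add_mul_eq_sum_choose (X : ℝ[X]) (C ((j : ℝ) + m * l)) (C l) n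
    convert this using 1
    · rw [prod_comp]
      refine Finset.prod_congr rfl fun i _ ↦ ?_
      simp
      ring
    · refine Finset.sum_congr rfl fun k _ ↦ ?_
      simp only [smul_eq_C_mul, map_mul, map_prod, map_add, map_natCast]
      ring
  rw [← hL, add_comm n m, Finset.prod_range_add, hpoly, Finset.sum_mul, map_sum,
    Finset.sum_comm]
  refine Finset.sum_congr rfl fun j _ ↦ ?_
  rw [← smul_eq_C_mul, smul_mul_assoc, map_smul, umbralFunctional_descPochhammer_mul, hshift,
    map_sum, smul_eq_mul, Finset.mul_sum, Finset.mul_sum]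
  refine Finset.sum_congr rfl fun k _ ↦ ?_
  rw [map_smul, hL, smul_eq_mul]
  ring
end

section
/- For all natural numbers n ≥ k ≥ 1, the Lah number admits the alternating-sum representation (1/k!) · Σ_{j=0}^{k} (-1)^{k-j} · C(k,j) · ⟨j⟩_n = (n!/k!) · C(n-1, k-1), where ⟨j⟩_n = ∏_{i=0}^{n-1}(j + i) is the rising factorial. -/
/-- The `k`-th finite difference of `x ↦ C(x, n)` at `m`, written as an alternating sum. -/
lemma Int.alternating_sum_choose_mul_add_choose (m : ℕ) {n k : ℕ} (hkn : k ≤ n) :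
    ∑ j ∈ Finset.range (k + 1), (-1 : ℤ) ^ (k - j) * (k.choose j : ℤ) * ((m + j).choose n : ℤ) =
      (m.choose (n - k) : ℤ) := by
  have h := congrFun (fwdDiff_iter_choose (n - k) k) m
  rw [fwdDiff_iter_eq_sum_shift, Nat.add_sub_of_le hkn] at h
  simpa using h

lemma prod_range_cast_add_cast (R : Type*) [CommSemiring R] (j n : ℕ) :
    ∏ i ∈ Finset.range n, ((j : R) + (i : R)) = n.factorial * ((j + n - 1).choose n : R) := by
  have h := Nat.ascFactorial_eq_factorial_mul_choose' j n
  rw [Nat.ascFactorial_eq_prod_range] at h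
  exact_mod_cast congrArg (Nat.cast : ℕ → R) h

/-- Alternating-sum representation of the Lah numbers:
`(1/k!) ∑_{j=0}^k (-1)^{k-j} C(k,j) ⟨j⟩_n = (n!/k!) C(n-1,k-1)` for `n ≥ k ≥ 1`. -/
theorem lah_alternating_sum (n k : ℕ) (hk : 1 ≤ k) (hkn : k ≤ n) :
    (1 / (k.factorial : ℝ)) *
        ∑ j ∈ Finset.range (k + 1),
          (-1 : ℝ) ^ (k - j) * (k.choose j : ℝ) *
            ∏ i ∈ Finset.range n, ((j : ℝ) + (i : ℝ)) =
      (n.factorial : ℝ) / (k.factorial : ℝ) * ((n - 1).choose (k - 1) : ℝ) := by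
  have hsum : ∑ j ∈ Finset.range (k + 1),
      (-1 : ℝ) ^ (k - j) * (k.choose j : ℝ) * ((n - 1 + j).choose n : ℝ) =
        ((n - 1).choose (k - 1) : ℝ) := by
    rw [← Nat.choose_symm_of_eq_add (show n - 1 = (n - k) + (k - 1) by lia)]
    exact_mod_cast congrArg (Int.cast : ℤ → ℝ)
      (Int.alternating_sum_choose_mul_add_choose (n - 1) hkn)
  rw [← hsum, Finset.mul_sum, Finset.mul_sum]
  refine Finset.sum_congr rfl fun j _ => ?_
  rw [prod_range_cast_add_cast, show j + n - 1 = n - 1 + j by lia]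
  ring
end

section
/- Let λ be a real number and let H : ℕ → ℕ → ℝ satisfy H(n,k) = 0 for k > n and, for all n and all real x, ⟨x⟩_{n,λ} = Σ_{k=0}^{n} H(n,k) · (x)_k (the heterogeneous Stirling numbers of the second kind). For a real constant c, let θ_c denote the linear operator on real polynomials given by θ_c(p) = X · p' + c · p, where p' is the derivative. Then for every natural number n and every polynomial p ∈ ℝ[X], the normal ordering identity holds: (θ_0 ∘ θ_λ ∘ θ_{2λ} ∘ ⋯ ∘ θ_{(n-1)λ})(p) = Σ_{k=0}^{n} H(n,k) · X^k · p^{(k)}, where p^{(k)} denotes the k-th derivative. (This is the operator identity ⟨xD⟩_{n,λ} = Σ_{k=0}^{n} H_λ(n,k) x^k D^k.) -/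
open Polynomial

/-- The operator `θ_c : p ↦ X p' + c p` on real polynomials. -/
noncomputable def theta (c : ℝ) (p : Polynomial ℝ) : Polynomial ℝ :=
  Polynomial.X * Polynomial.derivative p + Polynomial.C c * p

/-- The operator `⟨xD⟩_{n,λ} = θ_0 ∘ θ_λ ∘ ⋯ ∘ θ_{(n-1)λ}` on real polynomials. -/
noncomputable def thetaIter (l : ℝ) : ℕ → Polynomial ℝ → Polynomial ℝ
  | 0 => id
  | n + 1 => fun p => thetaIter l n (theta ((n : ℝ) * l) p)

theorem coeff_X_mul_derivative (p : ℝ[X]) (m : ℕ) :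
    (X * derivative p).coeff m = m * p.coeff m := by
  cases m with
  | zero => simp
  | succ m => rw [coeff_X_mul, coeff_derivative]; push_cast; ring

theorem coeff_theta (c : ℝ) (p : ℝ[X]) (m : ℕ) :
    (theta c p).coeff m = (m + c) * p.coeff m := by
  rw [theta, coeff_add, coeff_X_mul_derivative, coeff_C_mul, add_mul]

theorem coeff_thetaIter (l : ℝ) (n : ℕ) (p : ℝ[X]) (m : ℕ) :
    (thetaIter l n p).coeff m = (∏ i ∈ Finset.range n, ((m : ℝ) + i * l)) * p.coeff m := by
  induction n generalizing p with
  | zero => simp [thetaIter]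
  | succ n ih => rw [thetaIter, ih, coeff_theta, Finset.prod_range_succ, mul_assoc]

theorem coeff_X_pow_mul_iterate_derivative (k : ℕ) (p : ℝ[X]) (m : ℕ) :
    (X ^ k * (fun q => derivative q)^[k] p).coeff m =
      (∏ i ∈ Finset.range k, ((m : ℝ) - i)) * p.coeff m := by
  induction k generalizing p m with
  | zero => simp
  | succ k ih =>
    rw [Function.iterate_succ_apply, pow_succ', mul_assoc, Finset.prod_range_succ']
    cases m with
    | zero => simp
    | succ m =>
      rw [coeff_X_mul, ih, coeff_derivative]
      push_cast
      simp only [add_sub_add_right_eq_sub, sub_zero]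
      ring

/-- Normal ordering: `⟨xD⟩_{n,λ} = ∑_{k=0}^n H_λ(n,k) x^k D^k` as operators on `ℝ[X]`. -/
theorem heterogeneous_normal_ordering (l : ℝ) (H : ℕ → ℕ → ℝ)
    (hH0 : ∀ n k, n < k → H n k = 0)
    (hH : ∀ (n : ℕ) (x : ℝ),
      (∏ i ∈ Finset.range n, (x + (i : ℝ) * l)) =
        ∑ k ∈ Finset.range (n + 1), H n k * ∏ i ∈ Finset.range k, (x - (i : ℝ))) :
    ∀ (n : ℕ) (p : Polynomial ℝ),
      thetaIter l n p =
        ∑ k ∈ Finset.range (n + 1),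
          Polynomial.C (H n k) * Polynomial.X ^ k *
            ((fun q => Polynomial.derivative q)^[k] p) := by
  intro n p
  ext m
  simp only [coeff_thetaIter, hH, finsetSum_coeff, mul_assoc, coeff_C_mul,
    coeff_X_pow_mul_iterate_derivative, Finset.sum_mul]
end

section
/- Define the Lah numbers L(n,k) for natural numbers by L(0,0) = 1, L(n,0) = 0 for n ≥ 1, and L(n,k) = (n!/k!) · C(n-1, k-1) for n ≥ k ≥ 1 (and L(n,k) = 0 for k > n), and define the Lah-Bell numbers LB_n := Σ_{k=0}^{n} L(n,k). Then for all natural numbers m and n: LB_{n+m} = Σ_{j=0}^{m} Σ_{k=0}^{n} L(m,j) · C(n,k) · LB_k · ⟨m + j⟩_{n-k}, where ⟨m + j⟩_{n-k} = ∏_{i=0}^{n-k-1}(m + j + i) is the rising factorial. -/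
/-- The Lah numbers `L(n,k)`. -/
noncomputable def lahNumber (n k : ℕ) : ℝ :=
  if k = 0 then (if n = 0 then 1 else 0)
  else if k ≤ n then (n.factorial : ℝ) / (k.factorial : ℝ) * ((n - 1).choose (k - 1) : ℝ)
  else 0

/-- The Lah-Bell numbers `LB_n = ∑_{k=0}^n L(n,k)`. -/
noncomputable def lahBellNumber (n : ℕ) : ℝ :=
  ∑ k ∈ Finset.range (n + 1), lahNumber n k

/-- The rising factorial `⟨x⟩_n = ∏_{i<n} (x + i)`. -/
noncomputable def risingFactorial (x : ℝ) (n : ℕ) : ℝ :=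
  ∏ i ∈ Finset.range n, (x + (i : ℝ))

lemma risingFactorial_zero (x : ℝ) : risingFactorial x 0 = 1 := by
  simp [risingFactorial]

lemma risingFactorial_succ (x : ℝ) (n : ℕ) :
    risingFactorial x (n + 1) = risingFactorial x n * (x + n) := by
  simp [risingFactorial, Finset.prod_range_succ]

lemma risingFactorial_succ' (x : ℝ) (n : ℕ) :
    risingFactorial x (n + 1) = x * risingFactorial (x + 1) n := by
  simp only [risingFactorial, Finset.prod_range_succ', Nat.cast_zero, add_zero]
  rw [mul_comm]
  congr 1
  refine Finset.prod_congr rfl fun i _ => ?_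
  push_cast
  ring

lemma risingFactorial_add_one_sub (x : ℝ) (n : ℕ) :
    risingFactorial (x + 1) (n + 1) - risingFactorial x (n + 1) =
      (n + 1) * risingFactorial (x + 1) n := by
  rw [risingFactorial_succ, risingFactorial_succ' x]
  ring

/-- The shifted Lah-Bell numbers `∑_k C(n,k) ⟨c+k⟩_{n-k}`, with exponential generating function
`(1 - t)^{-c} exp (t / (1 - t))`. -/
noncomputable def shiftedLahBell (n : ℕ) (c : ℝ) : ℝ :=
  ∑ k ∈ Finset.range (n + 1), (n.choose k : ℝ) * risingFactorial (c + k) (n - k)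

lemma shiftedLahBell_add_one (n : ℕ) (c : ℝ) :
    shiftedLahBell n (c + 1) = shiftedLahBell n c +
      ∑ k ∈ Finset.range (n + 1), (n.choose k : ℝ) * (k * risingFactorial (c + k) (n - k)) := by
  rw [← sub_eq_iff_eq_add']
  simp only [shiftedLahBell]
  rw [← Finset.sum_sub_distrib, Finset.sum_range_succ, Finset.sum_range_succ']
  simp only [Nat.sub_self, risingFactorial_zero, sub_self, add_zero, Nat.cast_zero, zero_mul,
    mul_zero]
  refine Finset.sum_congr rfl fun k hk => ?_
  obtain ⟨d, rfl⟩ := Nat.exists_eq_add_of_lt (Finset.mem_range.mp hk)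
  have h := risingFactorial_add_one_sub (c + k) d
  have hc := Nat.choose_succ_right_eq (k + d + 1) k
  rw [show k + d + 1 - k = d + 1 by omega] at hc ⊢
  rw [show k + d + 1 - (k + 1) = d by omega]
  have hc' : ((k + d + 1).choose (k + 1) : ℝ) * (k + 1) = (k + d + 1).choose k * (d + 1) := by
    exact_mod_cast hc
  rw [show c + 1 + (k : ℝ) = c + k + 1 by ring, ← mul_sub, h]
  push_cast
  rw [show c + ((k : ℝ) + 1) = c + k + 1 by ring]
  linear_combination (-risingFactorial (c + k + 1) d) * hc'

lemma shiftedLahBell_succ (n : ℕ) (c : ℝ) :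
    shiftedLahBell (n + 1) c = c * shiftedLahBell n (c + 1) + shiftedLahBell n (c + 2) := by
  have h := Finset.sum_choose_succ_mul (fun k l => risingFactorial (c + k) l) n
  rw [show c + 2 = c + 1 + 1 by ring, shiftedLahBell_add_one n (c + 1)]
  simp only [shiftedLahBell]
  rw [h, Finset.mul_sum, ← Finset.sum_add_distrib, ← Finset.sum_add_distrib,
    ← Finset.sum_add_distrib]
  refine Finset.sum_congr rfl fun k hk => ?_
  rw [Nat.succ_sub (Finset.mem_range_succ_iff.mp hk), risingFactorial_succ']
  push_cast
  rw [show c + 1 + (k : ℝ) = c + k + 1 by ring, show c + ((k : ℝ) + 1) = c + k + 1 by ring]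
  ring

lemma sum_choose_mul_shiftedLahBell_mul_risingFactorial (n : ℕ) (c d : ℝ) :
    ∑ k ∈ Finset.range (n + 1),
      (n.choose k : ℝ) * (shiftedLahBell k d * risingFactorial c (n - k)) =
        shiftedLahBell n (c + d) := by
  induction n generalizing c d with
  | zero => simp [shiftedLahBell, risingFactorial]
  | succ n ih =>
    have h := Finset.sum_choose_succ_mul (fun k l => shiftedLahBell k d * risingFactorial c l) n
    rw [h, shiftedLahBell_succ, add_mul, show c + d + 2 = c + (d + 2) by ring, ← ih c (d + 2)]
    nth_rewrite 1 [show c + d + 1 = c + 1 + d by ring]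
    rw [show c + d + 1 = c + (d + 1) by ring, ← ih (c + 1) d, ← ih c (d + 1), Finset.mul_sum,
      Finset.mul_sum, ← Finset.sum_add_distrib, ← Finset.sum_add_distrib, ← Finset.sum_add_distrib]
    refine Finset.sum_congr rfl fun k hk => ?_
    rw [Nat.succ_sub (Finset.mem_range_succ_iff.mp hk), risingFactorial_succ', shiftedLahBell_succ]
    ring

lemma lahNumber_succ_succ (n k : ℕ) :
    lahNumber (n + 1) (k + 1) =
      ((n + 1).factorial : ℝ) / ((k + 1).factorial : ℝ) * (n.choose k : ℝ) := by
  by_cases h : k ≤ n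
  · simp [lahNumber, h]
  · simp [lahNumber, h, Nat.choose_eq_zero_of_lt (not_le.mp h)]

lemma lahNumber_succ_zero (n : ℕ) : lahNumber (n + 1) 0 = 0 := by
  simp [lahNumber]

lemma lahNumber_eq_zero_of_lt {n k : ℕ} (h : n < k) : lahNumber n k = 0 := by
  simp [lahNumber, Nat.ne_zero_of_lt h, not_le.mpr h]

lemma lahNumber_succ_succ_eq_add (n k : ℕ) :
    lahNumber (n + 1) (k + 1) = lahNumber n k + (n + k + 1) * lahNumber n (k + 1) := by
  cases n with
  | zero => cases k <;> simp [lahNumber]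
  | succ n =>
    cases k with
    | zero =>
      rw [lahNumber_succ_succ, lahNumber_succ_succ, lahNumber_succ_zero, Nat.factorial_succ (n + 1)]
      push_cast
      simp
    | succ k =>
      rw [lahNumber_succ_succ, lahNumber_succ_succ, lahNumber_succ_succ, Nat.factorial_succ (n + 1),
        Nat.factorial_succ (k + 1), Nat.choose_succ_succ]
      have hc : (n.choose (k + 1) : ℝ) * (k + 1) = n.choose k * (n - k) := by
        rcases le_or_gt k n with h | h
        · rw [← Nat.cast_sub h]
          exact_mod_cast Nat.choose_succ_right_eq n k
        · simp [Nat.choose_eq_zero_of_lt h, Nat.choose_eq_zero_of_lt (Nat.lt_succ_of_lt h)]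
      have hk : ((k + 1).factorial : ℝ) ≠ 0 := by positivity
      push_cast
      field_simp
      linear_combination -hc

lemma risingFactorial_natCast_add_one (k d : ℕ) :
    risingFactorial (k + 1) d = ((k + d).factorial : ℝ) / (k.factorial : ℝ) := by
  induction d with
  | zero => simp [risingFactorial, Nat.factorial_ne_zero]
  | succ d ih =>
    rw [risingFactorial_succ, ih, ← add_assoc, Nat.factorial_succ]
    push_cast
    ring

lemma lahNumber_eq_choose_mul_risingFactorial {n k : ℕ} (h : k ≤ n) :
    lahNumber n k = (n.choose k : ℝ) * risingFactorial k (n - k) := by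
  obtain ⟨d, rfl⟩ := Nat.exists_eq_add_of_le h
  rw [Nat.add_sub_cancel_left]
  cases k with
  | zero => cases d <;> simp [lahNumber, risingFactorial, Finset.prod_range_succ']
  | succ k =>
    rw [Nat.cast_add_choose, Nat.cast_succ, risingFactorial_natCast_add_one,
      show k + 1 + d = k + d + 1 by ring, lahNumber_succ_succ, Nat.cast_add_choose]
    ring

lemma lahBellNumber_eq_shiftedLahBell (n : ℕ) : lahBellNumber n = shiftedLahBell n 0 := by
  refine Finset.sum_congr rfl fun k hk => ?_
  rw [zero_add, lahNumber_eq_choose_mul_risingFactorial (Finset.mem_range_succ_iff.mp hk)]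

lemma shiftedLahBell_add (n m : ℕ) :
    shiftedLahBell (n + m) 0 =
      ∑ j ∈ Finset.range (m + 1), lahNumber m j * shiftedLahBell n (m + j) := by
  induction m generalizing n with
  | zero => simp [lahNumber]
  | succ m ih =>
    have hshift : ∑ j ∈ Finset.range (m + 1),
          (m + (j + 1 : ℕ)) * lahNumber m (j + 1) * shiftedLahBell n (m + (j + 1 : ℕ) + 1) =
        ∑ j ∈ Finset.range (m + 1),
          (m + j : ℝ) * lahNumber m j * shiftedLahBell n (m + j + 1) := by
      have h := Finset.sum_range_succ'
        (fun j : ℕ => (m + j : ℝ) * lahNumber m j * shiftedLahBell n (m + j + 1)) (m + 1)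
      have h0 : (m : ℝ) * lahNumber m 0 = 0 := by cases m <;> simp [lahNumber]
      rw [Finset.sum_range_succ, lahNumber_eq_zero_of_lt (Nat.lt_succ_self m)] at h
      simp only [Nat.cast_zero, add_zero, h0, mul_zero, zero_mul] at h
      exact h.symm
    rw [show n + (m + 1) = n + 1 + m by ring, ih, Finset.sum_range_succ' _ (m + 1),
      lahNumber_succ_zero, zero_mul, add_zero]
    calc
      _ = ∑ j ∈ Finset.range (m + 1),
            (m + j : ℝ) * lahNumber m j * shiftedLahBell n (m + j + 1) +
          ∑ j ∈ Finset.range (m + 1), lahNumber m j * shiftedLahBell n (m + j + 2) := by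
        rw [← Finset.sum_add_distrib]
        refine Finset.sum_congr rfl fun j _ => ?_
        rw [shiftedLahBell_succ]
        ring
      _ = _ := by
        rw [← hshift, ← Finset.sum_add_distrib]
        refine Finset.sum_congr rfl fun j _ => ?_
        rw [lahNumber_succ_succ_eq_add]
        push_cast
        rw [show (m : ℝ) + (j + 1) + 1 = m + j + 2 by ring,
          show (m : ℝ) + 1 + (j + 1) = m + j + 2 by ring]
        ring

/-- Spivey-type formula for the Lah-Bell numbers:
`LB_{n+m} = ∑_{j=0}^m ∑_{k=0}^n L(m,j) C(n,k) LB_k ⟨m+j⟩_{n-k}`. -/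
theorem lahBell_spivey (m n : ℕ) :
    lahBellNumber (n + m) =
      ∑ j ∈ Finset.range (m + 1), ∑ k ∈ Finset.range (n + 1),
        lahNumber m j * (n.choose k : ℝ) * lahBellNumber k *
          ∏ i ∈ Finset.range (n - k), ((m : ℝ) + (j : ℝ) + (i : ℝ)) := by
  rw [lahBellNumber_eq_shiftedLahBell, shiftedLahBell_add]
  refine Finset.sum_congr rfl fun j _ => ?_
  rw [← add_zero ((m : ℝ) + j), ← sum_choose_mul_shiftedLahBell_mul_risingFactorial,
    Finset.mul_sum]
  refine Finset.sum_congr rfl fun k _ => ?_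
  rw [lahBellNumber_eq_shiftedLahBell, add_zero, risingFactorial]
  ring
end

section
/- Define the Lah numbers L(n,k) by L(0,0) = 1, L(n,0) = 0 for n ≥ 1, L(n,k) = (n!/k!) · C(n-1, k-1) for n ≥ k ≥ 1, and L(n,k) = 0 for k > n, and define the Lah-Bell polynomials LB_n(x) := Σ_{k=0}^{n} L(n,k) x^k. Then for every natural number n and every real number x, the series Σ_{k=0}^{∞} ⟨k⟩_n · x^k / k! converges absolutely (is summable) and LB_n(x) = e^{-x} · Σ_{k=0}^{∞} ⟨k⟩_n · x^k / k!, where ⟨k⟩_n = ∏_{i=0}^{n-1}(k + i) is the rising factorial. -/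
/-- The Lah-Bell polynomials `LB_n(x) = ∑_{k=0}^n L(n,k) x^k`. -/
noncomputable def lahBellPoly (n : ℕ) (x : ℝ) : ℝ :=
  ∑ k ∈ Finset.range (n + 1), lahNumber n k * x ^ k

/-- Rising factorials expand in falling factorials with the Lah numbers as coefficients. -/
theorem ascFactorial_eq_sum_lahNumber (n k : ℕ) :
    (k.ascFactorial n : ℝ) =
      ∑ j ∈ Finset.range (n + 1), lahNumber n j * (k.descFactorial j : ℝ) := by
  rcases n with _ | m
  · simp [lahNumber]
  rw [Nat.ascFactorial_eq_factorial_mul_choose', ← add_assoc, Nat.add_sub_cancel,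
    Nat.add_choose_eq, Finset.Nat.sum_antidiagonal_eq_sum_range_succ_mk]
  push_cast
  rw [Finset.mul_sum]
  refine Finset.sum_congr rfl fun j hj => ?_
  have hjm : j ≤ m + 1 := Nat.lt_succ_iff.mp (Finset.mem_range.mp hj)
  rcases j with _ | j
  · simp [lahNumber]
  have hsymm : m.choose (m - j) = m.choose j := Nat.choose_symm (by lia)
  have hfac : ((j + 1).factorial : ℝ) ≠ 0 := by positivity
  simp only [lahNumber, Nat.succ_ne_zero, if_false, if_pos hjm, Nat.add_sub_cancel,
    Nat.add_sub_add_right, hsymm, Nat.descFactorial_eq_factorial_mul_choose, Nat.cast_mul]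
  field_simp

/-- The factorial moments of the exponential series. -/
theorem hasSum_descFactorial_mul_pow_div_factorial (j : ℕ) (x : ℝ) :
    HasSum (fun k : ℕ => (k.descFactorial j : ℝ) * x ^ k / (k.factorial : ℝ))
      (x ^ j * Real.exp x) := by
  have hexp : HasSum (fun k : ℕ => x ^ k / (k.factorial : ℝ)) (Real.exp x) := by
    rw [Real.exp_eq_exp_ℝ]
    exact NormedSpace.expSeries_div_hasSum_exp x
  refine ((add_left_injective j).hasSum_iff fun k hk => ?_).mp ?_
  · have hkj : k < j := by
      by_contra! h
      exact hk ⟨k - j, Nat.sub_add_cancel h⟩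
    simp [Nat.descFactorial_of_lt hkj]
  · convert! hexp.mul_left (x ^ j) using 2 with k
    have hfac : (k.factorial : ℝ) * ((k + j).descFactorial j : ℝ) = ((k + j).factorial : ℝ) := by
      have := Nat.factorial_mul_descFactorial (Nat.le_add_left j k)
      rw [Nat.add_sub_cancel] at this
      exact_mod_cast this
    have hk : (k.factorial : ℝ) ≠ 0 := by positivity
    have hkj : ((k + j).factorial : ℝ) ≠ 0 := by positivity
    simp only [Function.comp_apply]
    rw [mul_div_assoc', div_eq_div_iff hkj hk, ← hfac]
    ring

theorem hasSum_prod_add_mul_pow_div_factorial (n : ℕ) (x : ℝ) :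
    HasSum (fun k : ℕ =>
      (∏ i ∈ Finset.range n, ((k : ℝ) + (i : ℝ))) * x ^ k / (k.factorial : ℝ))
      (lahBellPoly n x * Real.exp x) := by
  have hsum := hasSum_sum fun j (_ : j ∈ Finset.range (n + 1)) =>
    (hasSum_descFactorial_mul_pow_div_factorial j x).mul_left (lahNumber n j)
  convert! hsum using 1
  · funext k
    have hprod : ∏ i ∈ Finset.range n, ((k : ℝ) + (i : ℝ)) = (k.ascFactorial n : ℝ) := by
      rw [Nat.ascFactorial_eq_prod_range]
      push_cast
      rfl
    rw [hprod, ascFactorial_eq_sum_lahNumber, Finset.sum_mul, Finset.sum_div]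
    exact Finset.sum_congr rfl fun j _ => by ring
  · rw [lahBellPoly, Finset.sum_mul]
    exact Finset.sum_congr rfl fun j _ => by ring

/-- Dobinski-like formula for the Lah-Bell polynomials:
`LB_n(x) = e^{-x} ∑_{k=0}^∞ ⟨k⟩_n x^k / k!`, the series being summable. -/
theorem lahBell_dobinski (n : ℕ) (x : ℝ) :
    Summable (fun k : ℕ =>
      (∏ i ∈ Finset.range n, ((k : ℝ) + (i : ℝ))) * x ^ k / (k.factorial : ℝ)) ∧
    lahBellPoly n x =
      Real.exp (-x) * ∑' k : ℕ,
        (∏ i ∈ Finset.range n, ((k : ℝ) + (i : ℝ))) * x ^ k / (k.factorial : ℝ) := by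
  have h := hasSum_prod_add_mul_pow_div_factorial n x
  refine ⟨h.summable, ?_⟩
  rw [h.tsum_eq, mul_left_comm, ← Real.exp_add, neg_add_cancel, Real.exp_zero, mul_one]
end

section
/- Let S2 : ℕ → ℕ → ℝ satisfy S2(n,k) = 0 for k > n and, for all natural numbers n and all real x, x^n = Σ_{k=0}^{n} S2(n,k) · (x)_k (the Stirling numbers of the second kind), and define the Bell numbers φ_n := Σ_{k=0}^{n} S2(n,k). Then Spivey's formula holds: for all natural numbers m and n, φ_{m+n} = Σ_{j=0}^{m} Σ_{k=0}^{n} S2(m,j) · C(n,k) · φ_k · j^{n-k}. -/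
open Finset in
theorem prod_range_natCast_add_sub_mul_factorial (s k : ℕ) :
    (∏ i ∈ range k, (((s + k : ℕ) : ℝ) - (i : ℝ))) * (s.factorial : ℝ) =
      ((s + k).factorial : ℝ) := by
  induction k with
  | zero => simp
  | succ k ih =>
    have h : ∏ i ∈ range k, (((s + (k + 1) : ℕ) : ℝ) - ((i + 1 : ℕ) : ℝ)) =
        ∏ i ∈ range k, (((s + k : ℕ) : ℝ) - (i : ℝ)) :=
      prod_congr rfl fun i _ => by push_cast; ring
    rw [prod_range_succ', h, ← add_assoc, Nat.factorial_succ]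
    push_cast at ih ⊢
    rw [← ih]
    ring

open Finset in
/-- Multiplying by the falling factorial `(r)_k` in a series weighted by `1 / r!` shifts the
summand by `k`. -/
theorem hasSum_fallingFactorial_mul_div_factorial {f : ℕ → ℝ} {a : ℝ} (k : ℕ)
    (hf : HasSum (fun s : ℕ => f (s + k) / (s.factorial : ℝ)) a) :
    HasSum (fun r : ℕ => (∏ i ∈ range k, ((r : ℝ) - (i : ℝ))) * f r / (r.factorial : ℝ)) a := by
  rw [← (add_left_injective k).hasSum_iff]
  · refine hf.congr_fun fun s => ?_
    have h := prod_range_natCast_add_sub_mul_factorial s k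
    have h₁ : (s.factorial : ℝ) ≠ 0 := by positivity
    have h₂ : ((s + k).factorial : ℝ) ≠ 0 := by positivity
    simp only [Function.comp_apply]
    rw [div_eq_div_iff h₂ h₁, ← h]
    ring
  · intro r hr
    have hrk : r < k := by
      by_contra! hle
      exact hr ⟨r - k, Nat.sub_add_cancel hle⟩
    rw [prod_eq_zero (mem_range.mpr hrk) (sub_self _)]
    simp

open Finset in
/-- Dobiński's formula. -/
theorem hasSum_pow_div_factorial {c : ℕ → ℝ} {n : ℕ}
    (hc : ∀ x : ℝ, x ^ n = ∑ k ∈ range (n + 1), c k * ∏ i ∈ range k, (x - (i : ℝ))) :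
    HasSum (fun r : ℕ => (r : ℝ) ^ n / (r.factorial : ℝ))
      ((∑ k ∈ range (n + 1), c k) * Real.exp 1) := by
  have hexp : HasSum (fun r : ℕ => (1 : ℝ) / (r.factorial : ℝ)) (Real.exp 1) := by
    have h := NormedSpace.expSeries_div_hasSum_exp (1 : ℝ)
    rw [← Real.exp_eq_exp_ℝ] at h
    simpa using h
  rw [sum_mul]
  refine (hasSum_sum fun k _ => (hasSum_fallingFactorial_mul_div_factorial (f := fun _ => 1) k
    hexp).mul_left (c k)).congr_fun fun r => ?_
  rw [hc, sum_div]
  exact sum_congr rfl fun k _ => by ring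

/-- Spivey's Bell number formula:
`φ_{m+n} = ∑_{j=0}^m ∑_{k=0}^n S2(m,j) C(n,k) φ_k j^{n-k}`. -/
theorem spivey_bell_formula
    (S2 : ℕ → ℕ → ℝ)
    (hS20 : ∀ n k, n < k → S2 n k = 0)
    (hS2 : ∀ (n : ℕ) (x : ℝ),
      x ^ n = ∑ k ∈ Finset.range (n + 1), S2 n k * ∏ i ∈ Finset.range k, (x - (i : ℝ)))
    (phi : ℕ → ℝ)
    (hphi : ∀ n : ℕ, phi n = ∑ k ∈ Finset.range (n + 1), S2 n k) :
    ∀ m n : ℕ,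
      phi (m + n) =
        ∑ j ∈ Finset.range (m + 1), ∑ k ∈ Finset.range (n + 1),
          S2 m j * (n.choose k : ℝ) * phi k * (j : ℝ) ^ (n - k) := by
  intro m n
  have dobinski (k : ℕ) :
      HasSum (fun r : ℕ => (r : ℝ) ^ k / (r.factorial : ℝ)) (phi k * Real.exp 1) :=
    hphi k ▸ hasSum_pow_div_factorial (hS2 k)
  have shifted (j : ℕ) : HasSum (fun s : ℕ => ((s + j : ℕ) : ℝ) ^ n / (s.factorial : ℝ))
      (∑ k ∈ Finset.range (n + 1), (n.choose k : ℝ) * (j : ℝ) ^ (n - k) *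
        (phi k * Real.exp 1)) := by
    refine (hasSum_sum fun k _ =>
      (dobinski k).mul_left ((n.choose k : ℝ) * (j : ℝ) ^ (n - k))).congr_fun fun s => ?_
    rw [Nat.cast_add, add_pow, Finset.sum_div]
    exact Finset.sum_congr rfl fun k _ => by ring
  have expanded : HasSum (fun r : ℕ => (r : ℝ) ^ (m + n) / (r.factorial : ℝ))
      (∑ j ∈ Finset.range (m + 1), S2 m j * ∑ k ∈ Finset.range (n + 1),
        (n.choose k : ℝ) * (j : ℝ) ^ (n - k) * (phi k * Real.exp 1)) := by
    refine (hasSum_sum fun j _ => (hasSum_fallingFactorial_mul_div_factorial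
      (f := fun r => (r : ℝ) ^ n) j (shifted j)).mul_left (S2 m j)).congr_fun fun r => ?_
    rw [pow_add, hS2 m, Finset.sum_mul, Finset.sum_div]
    exact Finset.sum_congr rfl fun j _ => by ring
  refine mul_right_cancel₀ (Real.exp_ne_zero 1) (((dobinski (m + n)).unique expanded).trans ?_)
  simp only [Finset.sum_mul, Finset.mul_sum]
  exact Finset.sum_congr rfl fun j _ => Finset.sum_congr rfl fun k _ => by ring
end
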